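/- Let r and s be coprime positive integers with s > 1. Then for every natural number k, the generalized binomial coefficient C(r/s, k) lies in ℤ[1/s]; that is, there exist n ∈ ℤ and m ∈ ℤ_{≥0} such that C(r/s, k) = n / s^m. -/

import Mathlib

/-- The generalized binomial coefficient `C(x, k) = x(x-1)⋯(x-k+1)/k!`. -/
def gchoose (x : ℚ) (k : ℕ) : ℚ := (∏ i ∈ Finset.range k, (x - i)) / (Nat.factorial k)

/-- Every positive integer is the product of a divisor of a power of `s` and a number
coprime to `s`. -/
theorem exists_eq_mul_dvd_pow_coprime (s n : ℕ) (hn : 0 < n) :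
    ∃ a b m : ℕ, n = a * b ∧ a ∣ s ^ m ∧ Nat.Coprime b s := by
  induction n using Nat.strong_induction_on with
  | _ n ih =>
    by_cases hg : Nat.Coprime n s
    · exact ⟨1, n, 0, by simp, by simp, hg⟩
    · obtain ⟨c, hc⟩ := Nat.gcd_dvd_left n s
      have hgpos : 0 < n.gcd s := Nat.gcd_pos_of_pos_left s hn
      have hg2 : 1 < n.gcd s := lt_of_le_of_ne hgpos (Ne.symm hg)
      have hcpos : 0 < c := Nat.pos_of_ne_zero (by rintro rfl; omega)
      obtain ⟨a, b, m, hab, ha, hb⟩ := ih c (by nlinarith) hcpos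
      refine ⟨n.gcd s * a, b, m + 1, ?_, ?_, hb⟩
      · rw [mul_assoc, ← hab]
        exact hc
      · rw [pow_succ']
        exact mul_dvd_mul (Nat.gcd_dvd_right n s) ha

theorem factorial_dvd_prod_sub (z : ℤ) (k : ℕ) :
    (k.factorial : ℤ) ∣ ∏ i ∈ Finset.range k, (z - i) := by
  have h := Ring.descPochhammer_eq_factorial_smul_choose z k
  rw [← Polynomial.eval_eq_smeval, descPochhammer_eval_eq_prod_range, nsmul_eq_mul] at h
  exact ⟨_, h⟩

/-- A divisor of `k!` coprime to `s` divides `r(r-s)⋯(r-(k-1)s)`. -/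
theorem dvd_prod_sub_mul_of_isCoprime {b s : ℤ} (r : ℤ) {k : ℕ} (hb : b ∣ k.factorial)
    (hco : IsCoprime b s) : b ∣ ∏ i ∈ Finset.range k, (r - i * s) := by
  obtain ⟨u, t, hut⟩ := hco
  have ht : IsCoprime b (t ^ k) := IsCoprime.pow_right ⟨u, s, by linarith⟩
  refine ht.dvd_of_dvd_mul_left ?_
  have hmod : t ^ k * ∏ i ∈ Finset.range k, (r - i * s) ≡
      ∏ i ∈ Finset.range k, (t * r - i) [ZMOD b] := by
    rw [Finset.pow_eq_prod_const, ← Finset.prod_mul_distrib]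
    refine Int.ModEq.prod fun i _ => ?_
    refine Int.modEq_iff_dvd.mpr ⟨-(i * u), ?_⟩
    linear_combination (i : ℤ) * hut
  exact hmod.dvd_iff.mpr (hb.trans (factorial_dvd_prod_sub _ k))

theorem stmt_6 (r s : ℕ) (hr : 0 < r) (hs : 1 < s) (hco : Nat.Coprime r s) (k : ℕ) :
    ∃ (n : ℤ) (m : ℕ), gchoose ((r : ℚ) / (s : ℚ)) k = (n : ℚ) / (s : ℚ) ^ m := by
  obtain ⟨a, b, m, hab, ha, hb⟩ := exists_eq_mul_dvd_pow_coprime s _ k.factorial_pos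
  have hbP : (b : ℤ) ∣ ∏ i ∈ Finset.range k, ((r : ℤ) - i * s) :=
    dvd_prod_sub_mul_of_isCoprime _ (Int.natCast_dvd_natCast.mpr (Dvd.intro_left a hab.symm))
      (Nat.isCoprime_iff_coprime.mpr hb)
  have hdvd : (k.factorial : ℤ) ∣ (s : ℤ) ^ m * ∏ i ∈ Finset.range k, ((r : ℤ) - i * s) := by
    rw [hab, Nat.cast_mul]
    exact mul_dvd_mul (by exact_mod_cast ha) hbP
  obtain ⟨n, hn⟩ := hdvd
  have hs0 : (s : ℚ) ≠ 0 := by positivity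
  have hk0 : (k.factorial : ℚ) ≠ 0 := by positivity
  have hprod : (s : ℚ) ^ k * ∏ i ∈ Finset.range k, ((r : ℚ) / s - i) =
      ∏ i ∈ Finset.range k, ((r : ℚ) - i * s) := by
    rw [Finset.pow_eq_prod_const, ← Finset.prod_mul_distrib]
    refine Finset.prod_congr rfl fun i _ => ?_
    field_simp
  have hnQ : (s : ℚ) ^ m * ∏ i ∈ Finset.range k, ((r : ℚ) - i * s) = k.factorial * n := by
    exact_mod_cast congrArg (Int.cast : ℤ → ℚ) hn
  refine ⟨n, m + k, ?_⟩
  rw [gchoose, div_eq_div_iff hk0 (by positivity), pow_add]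
  linear_combination hnQ + (s : ℚ) ^ m * hprod
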